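/- Let r ≥ 0 be an integer and let p and q be polynomials in two real variables of total degree at most r. Let B be the open unit ball in ℝ², and let f : ℝ² → ℝ be a function that is r times continuously differentiable on B, such that f(x₁, x₂) = p(x₁, x₂) for all (x₁, x₂) ∈ B with x₁ < 0 and f(x₁, x₂) = q(x₁, x₂) for all (x₁, x₂) ∈ B with x₁ > 0. Then p = q. -/

import Mathlib

open Filter Topology

/-- The iterated derivatives of the function attached to a polynomial. -/
theorem Polynomial.iteratedDeriv_eval (P : Polynomial ℝ) (k : ℕ) :
    iteratedDeriv k (fun t => P.eval t) = fun t => (Polynomial.derivative^[k] P).eval t := by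
  induction k with
  | zero => simp
  | succ k ih =>
    rw [iteratedDeriv_succ, ih]
    ext t
    rw [Function.iterate_succ_apply', Polynomial.deriv]

/-- If a `C^n` function agrees with a polynomial on an open set accumulating at `a`, then their
derivatives at `a` agree up to order `n`. -/
theorem ContDiffAt.iteratedDeriv_eq_of_eventuallyEq_polynomial {g : ℝ → ℝ} {P : Polynomial ℝ}
    {s : Set ℝ} {a : ℝ} {n k : ℕ} (hs : IsOpen s) [(𝓝[s] a).NeBot]
    (hg : ContDiffAt ℝ n g a) (hgP : g =ᶠ[𝓝[s] a] fun t => P.eval t) (hk : k ≤ n) :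
    iteratedDeriv k g a = (Polynomial.derivative^[k] P).eval a := by
  have hcont : ContinuousAt (iteratedDeriv k g) a := by
    rw [iteratedDeriv_eq_equiv_comp]
    exact (LinearIsometryEquiv.continuous _).continuousAt.comp
      (hg.continuousAt_iteratedFDeriv (mod_cast hk))
  have heq : iteratedDeriv k g =ᶠ[𝓝[s] a] fun t => (Polynomial.derivative^[k] P).eval t := by
    filter_upwards [eventually_eventually_nhdsWithin.2 hgP, self_mem_nhdsWithin] with t ht hts
    rw [hs.nhdsWithin_eq hts] at ht
    exact (Filter.EventuallyEq.iteratedDeriv_eq k ht).trans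
      (congrFun (P.iteratedDeriv_eval k) t)
  exact tendsto_nhds_unique (hcont.tendsto.mono_left nhdsWithin_le_nhds)
    (((Polynomial.derivative^[k] P).continuous.tendsto a |>.mono_left nhdsWithin_le_nhds).congr'
      heq.symm)

/-- Two univariate polynomials of degree at most `r` glued at `0` to a `C^r` function coincide. -/
theorem Polynomial.eq_of_contDiffAt_glue {g : ℝ → ℝ} {P Q : Polynomial ℝ} {r : ℕ}
    (hP : P.natDegree ≤ r) (hQ : Q.natDegree ≤ r) (hg : ContDiffAt ℝ r g 0)
    (hgP : g =ᶠ[𝓝[<] 0] fun t => P.eval t) (hgQ : g =ᶠ[𝓝[>] 0] fun t => Q.eval t) :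
    P = Q := by
  rw [Polynomial.ext_iff_natDegree_le hP hQ]
  intro k hk
  have h := (hg.iteratedDeriv_eq_of_eventuallyEq_polynomial isOpen_Iio hgP hk).symm.trans
    (hg.iteratedDeriv_eq_of_eventuallyEq_polynomial isOpen_Ioi hgQ hk)
  simpa [← Polynomial.coeff_zero_eq_eval_zero, Polynomial.coeff_iterate_derivative,
    Nat.descFactorial_self, Nat.factorial_ne_zero] using h

/-- The restriction of a multivariate polynomial to the line through `0` spanned by `v`. -/
noncomputable def MvPolynomial.restrictLine {σ : Type*} (v : σ → ℝ) (p : MvPolynomial σ ℝ) :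
    Polynomial ℝ :=
  MvPolynomial.aeval (fun i => Polynomial.C (v i) * Polynomial.X) p

theorem MvPolynomial.eval_restrictLine {σ : Type*} (v : σ → ℝ) (p : MvPolynomial σ ℝ) (t : ℝ) :
    (p.restrictLine v).eval t = MvPolynomial.eval (fun i => v i * t) p := by
  rw [restrictLine, ← Polynomial.coe_aeval_eq_eval, ← MvPolynomial.coe_aeval_eq_eval]
  simp [← AlgHom.comp_apply, MvPolynomial.comp_aeval]

theorem MvPolynomial.natDegree_restrictLine_le {σ : Type*} (v : σ → ℝ) {p : MvPolynomial σ ℝ}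
    {r : ℕ} (hp : p.totalDegree ≤ r) : (p.restrictLine v).natDegree ≤ r := by
  simpa [restrictLine] using MvPolynomial.aeval_natDegree_le p hp
    (fun i => Polynomial.C (v i) * Polynomial.X) (n := 1)
    (fun i => (Polynomial.natDegree_C_mul_le _ _).trans Polynomial.natDegree_X_le)

/-- Key step of Lemma 3 of the paper: if a function `f` on the open unit ball `B ⊆ ℝ²`
is `C^r` on `B` and coincides with a polynomial `p` of total degree `≤ r` on the part
of `B` with `x₁ < 0` and with a polynomial `q` of total degree `≤ r` on the part with
`x₁ > 0`, then `p = q`. -/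
theorem piecewise_polynomial_Cr_implies_equal
    (r : ℕ) (p q : MvPolynomial (Fin 2) ℝ)
    (hp : p.totalDegree ≤ r) (hq : q.totalDegree ≤ r)
    (f : EuclideanSpace ℝ (Fin 2) → ℝ)
    (hf : ContDiffOn ℝ r f (Metric.ball 0 1))
    (hfp : ∀ x ∈ Metric.ball (0 : EuclideanSpace ℝ (Fin 2)) 1,
        x 0 < 0 → f x = MvPolynomial.eval (fun i => x i) p)
    (hfq : ∀ x ∈ Metric.ball (0 : EuclideanSpace ℝ (Fin 2)) 1,
        0 < x 0 → f x = MvPolynomial.eval (fun i => x i) q) :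
    p = q := by
  have hline : ∀ v : Fin 2 → ℝ, 0 < v 0 → p.restrictLine v = q.restrictLine v := by
    intro v hv
    let c : ℝ → EuclideanSpace ℝ (Fin 2) := fun t => t • WithLp.toLp 2 v
    have hc : ContDiff ℝ r c := by fun_prop
    have hc0 : c 0 = 0 := zero_smul _ _
    have hci : ∀ t i, c t i = v i * t := fun t i => by simp [c, mul_comm]
    have hball : ∀ᶠ t in 𝓝 0, c t ∈ Metric.ball (0 : EuclideanSpace ℝ (Fin 2)) 1 :=
      hc.continuous.continuousAt.eventually_mem
        (by rw [hc0]; exact Metric.ball_mem_nhds 0 one_pos)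
    refine Polynomial.eq_of_contDiffAt_glue (g := f ∘ c)
      (MvPolynomial.natDegree_restrictLine_le v hp)
      (MvPolynomial.natDegree_restrictLine_le v hq) ?_ ?_ ?_
    · refine ContDiffAt.comp 0 ?_ hc.contDiffAt
      rw [hc0]
      exact hf.contDiffAt (Metric.ball_mem_nhds 0 one_pos)
    · filter_upwards [nhdsWithin_le_nhds hball, self_mem_nhdsWithin] with t ht hneg
      rw [Function.comp_apply, hfp _ ht (by rw [hci]; exact mul_neg_of_pos_of_neg hv hneg),
        MvPolynomial.eval_restrictLine]
      simp only [hci]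
    · filter_upwards [nhdsWithin_le_nhds hball, self_mem_nhdsWithin] with t ht hpos
      rw [Function.comp_apply, hfq _ ht (by rw [hci]; exact mul_pos hv hpos),
        MvPolynomial.eval_restrictLine]
      simp only [hci]
  have heval : ∀ v : Fin 2 → ℝ, v 0 ≠ 0 → MvPolynomial.eval v p = MvPolynomial.eval v q := by
    intro v hv
    rcases hv.lt_or_gt with h | h
    · simpa [MvPolynomial.eval_restrictLine] using
        congrArg (Polynomial.eval (-1)) (hline (fun i => -v i) (by simpa using h))
    · simpa [MvPolynomial.eval_restrictLine] using congrArg (Polynomial.eval 1) (hline v h)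
  refine mul_left_cancel₀ (MvPolynomial.X_ne_zero (0 : Fin 2)) (MvPolynomial.funext fun v => ?_)
  rcases eq_or_ne (v 0) 0 with h | h
  · simp [h]
  · simp [heval v h]
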